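/- arXiv:2603.19861 — 3 statements merged into one kernel-verified Lean document; each statement's English description precedes it below -/
import Mathlib

section
/- Let n ≥ 1, R > 0, a ∈ ℝ, and constants e₂ > 0, 0 < e₃ ≤ e₄. Let A : ℝⁿ → Matrix (Fin n) (Fin n) ℝ be continuous with A(x) symmetric positive semidefinite and ⟨ξ, A(x) ξ⟩ ≤ e₂‖ξ‖² for all x ∈ closedBall(0,3R) and ξ ∈ ℝⁿ. Let ρ : ℝⁿ → ℝ be continuous with e₃ ≤ ρ(x) ≤ e₄ for x ∈ closedBall(0,3R), and let c : ℝⁿ → ℝ be continuous. Let η : ℝⁿ → ℝ be continuously differentiable with 0 ≤ η ≤ 1, η ≡ 1 on closedBall(0,R), and η ≡ 0 outside closedBall(0,3R). For s > 0 define Q(s) = (∫_{closedBall(0,3R)} e^{s(a−‖x‖²)} (⟨∇η(x), A(x)∇η(x)⟩ + c(x) η(x)²) ρ(x) dx) / (∫_{closedBall(0,3R)} e^{s(a−‖x‖²)} η(x)² ρ(x) dx). Then limsup_{s→+∞} Q(s) ≤ sup_{x ∈ closedBall(0,3R)} c(x). -/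
open MeasureTheory

/-- The quadratic form `⟨ξ, M ζ⟩ = ∑ᵢⱼ ξᵢ Mᵢⱼ ζⱼ` (Euclidean inner product of `ξ`
with the matrix-vector product `M ζ`). -/
noncomputable def quadForm {n : ℕ} (M : Matrix (Fin n) (Fin n) ℝ)
    (ξ ζ : EuclideanSpace ℝ (Fin n)) : ℝ :=
  ∑ i, ∑ j, ξ i * M i j * ζ j

open Metric Filter Topology

/-- Continuity of the quadratic form in all its arguments. -/
theorem Continuous.quadForm {X : Type*} [TopologicalSpace X] {n : ℕ}
    {M : X → Matrix (Fin n) (Fin n) ℝ} {ξ ζ : X → EuclideanSpace ℝ (Fin n)}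
    (hM : Continuous M) (hξ : Continuous ξ) (hζ : Continuous ζ) :
    Continuous fun x => quadForm (M x) (ξ x) (ζ x) := by
  unfold _root_.quadForm
  refine continuous_finsetSum _ fun i _ => continuous_finsetSum _ fun j _ => ?_
  have := hM.matrix_elem i j
  fun_prop

theorem ContDiff.continuous_gradient {E : Type*} [NormedAddCommGroup E] [InnerProductSpace ℝ E]
    [CompleteSpace E] {f : E → ℝ} (hf : ContDiff ℝ 1 f) : Continuous (gradient f) :=
  (InnerProductSpace.toDual ℝ E).symm.continuous.comp (hf.continuous_fderiv one_ne_zero)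

theorem gradient_eq_zero_of_eqOn_ball {E : Type*} [NormedAddCommGroup E] [InnerProductSpace ℝ E]
    [CompleteSpace E] {f : E → ℝ} {r b : ℝ} {y x : E}
    (hf : ∀ z ∈ closedBall y r, f z = b) (hx : x ∈ ball y r) : gradient f x = 0 := by
  have h : f =ᶠ[𝓝 x] fun _ => b := by
    filter_upwards [isOpen_ball.mem_nhds hx] with z hz using hf z (ball_subset_closedBall hz)
  rw [h.gradient_eq, gradient_fun_const]

section Laplace

variable {E : Type*} [NormedAddCommGroup E] [InnerProductSpace ℝ E] [FiniteDimensional ℝ E]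
  [MeasurableSpace E] [BorelSpace E]

theorem integrableOn_exp_mul_closedBall {g : E → ℝ} (hg : Continuous g) (s a r : ℝ) :
    IntegrableOn (fun x => Real.exp (s * (a - ‖x‖ ^ 2)) * g x) (closedBall 0 r) := by
  have : Continuous fun x : E => Real.exp (s * (a - ‖x‖ ^ 2)) * g x := by fun_prop
  exact this.continuousOn.integrableOn_compact (isCompact_closedBall 0 r)

/-- Mass of the Gaussian weight near the origin. -/
theorem mul_exp_le_setIntegral_exp_mul {w : E → ℝ} {r r' a δ s : ℝ} (hr : r ≤ r') (hs : 0 ≤ s)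
    (hr0 : 0 ≤ r) (hδ : 0 ≤ δ) (hw : Continuous w) (hw0 : ∀ x ∈ closedBall (0 : E) r', 0 ≤ w x)
    (hwδ : ∀ x ∈ closedBall (0 : E) r, δ ≤ w x) :
    volume.real (closedBall (0 : E) r) * (Real.exp (s * (a - r ^ 2)) * δ) ≤
      ∫ x in closedBall (0 : E) r', Real.exp (s * (a - ‖x‖ ^ 2)) * w x := by
  calc
    _ = ∫ _ in closedBall (0 : E) r, Real.exp (s * (a - r ^ 2)) * δ := by simp
    _ ≤ ∫ x in closedBall (0 : E) r, Real.exp (s * (a - ‖x‖ ^ 2)) * w x := by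
      refine setIntegral_mono_on (integrableOn_const measure_closedBall_lt_top.ne)
        (integrableOn_exp_mul_closedBall hw s a r) measurableSet_closedBall fun x hx => ?_
      have hxr : ‖x‖ ≤ r := by simpa using hx
      have := hwδ x hx
      gcongr
    _ ≤ _ := by
      refine setIntegral_mono_set (integrableOn_exp_mul_closedBall hw s a r') ?_
        (closedBall_subset_closedBall hr).eventuallyLE
      filter_upwards [ae_restrict_mem measurableSet_closedBall] with x hx
      exact mul_nonneg (Real.exp_nonneg _) (hw0 x hx)

/-- The Gaussian weight is exponentially small away from the origin. -/
theorem setIntegral_exp_mul_le {q : E → ℝ} {r r' a s : ℝ} (hr0 : 0 ≤ r) (hs : 0 ≤ s)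
    (hq : Continuous q) (hq0 : ∀ x ∈ closedBall (0 : E) r', 0 ≤ q x)
    (hqr : ∀ x ∈ ball (0 : E) r, q x = 0) :
    ∫ x in closedBall (0 : E) r', Real.exp (s * (a - ‖x‖ ^ 2)) * q x ≤
      Real.exp (s * (a - r ^ 2)) * ∫ x in closedBall (0 : E) r', q x := by
  rw [← integral_const_mul]
  refine setIntegral_mono_on (integrableOn_exp_mul_closedBall hq s a r')
    ((hq.continuousOn.integrableOn_compact (isCompact_closedBall 0 r')).const_mul _)
    measurableSet_closedBall fun x hx => ?_
  by_cases h : x ∈ ball (0 : E) r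
  · simp [hqr x h]
  · have hxr : r ≤ ‖x‖ := by simpa using h
    have := hq0 x hx
    gcongr

/-- Functions vanishing near the origin contribute negligibly under the weight
`exp (s * (a - ‖x‖ ^ 2))` as `s → ∞`. -/
theorem tendsto_setIntegral_exp_mul_div_zero {q w : E → ℝ} {r r' a δ : ℝ} (hr0 : 0 < r)
    (hr : r ≤ r') (hδ : 0 < δ) (hq : Continuous q) (hq0 : ∀ x ∈ closedBall (0 : E) r', 0 ≤ q x)
    (hqr : ∀ x ∈ ball (0 : E) r, q x = 0) (hw : Continuous w)
    (hw0 : ∀ x ∈ closedBall (0 : E) r', 0 ≤ w x) (hwδ : ∀ x ∈ closedBall (0 : E) r, δ ≤ w x) :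
    Tendsto (fun s : ℝ =>
      (∫ x in closedBall (0 : E) r', Real.exp (s * (a - ‖x‖ ^ 2)) * q x) /
        ∫ x in closedBall (0 : E) r', Real.exp (s * (a - ‖x‖ ^ 2)) * w x) atTop (𝓝 0) := by
  set K := ∫ x in closedBall (0 : E) r', q x
  set V := volume.real (closedBall (0 : E) (r / 2))
  have hK : 0 ≤ K := setIntegral_nonneg measurableSet_closedBall hq0
  have hV : 0 < V :=
    ENNReal.toReal_pos (measure_closedBall_pos _ _ (by positivity)).ne'
      measure_closedBall_lt_top.ne
  have hlim : Tendsto (fun s : ℝ => K / (V * δ) * Real.exp (-(3 / 4 * r ^ 2 * s))) atTop (𝓝 0) := by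
    rw [← mul_zero (K / (V * δ))]
    exact (Real.tendsto_exp_neg_atTop_nhds_zero.comp
      (tendsto_id.const_mul_atTop (by positivity : 0 < 3 / 4 * r ^ 2))).const_mul _
  refine tendsto_of_tendsto_of_tendsto_of_le_of_le' tendsto_const_nhds hlim
    (Eventually.of_forall fun s => ?_) ?_
  · exact div_nonneg
      (setIntegral_nonneg measurableSet_closedBall fun x hx =>
        mul_nonneg (Real.exp_nonneg _) (hq0 x hx))
      (setIntegral_nonneg measurableSet_closedBall fun x hx =>
        mul_nonneg (Real.exp_nonneg _) (hw0 x hx))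
  filter_upwards [eventually_ge_atTop 0] with s hs
  calc
    _ ≤ Real.exp (s * (a - r ^ 2)) * K / (V * (Real.exp (s * (a - (r / 2) ^ 2)) * δ)) := by
      gcongr
      · exact setIntegral_exp_mul_le hr0.le hs hq hq0 hqr
      · exact mul_exp_le_setIntegral_exp_mul (by linarith) hs (by positivity) hδ.le hw hw0
          fun x hx => hwδ x (closedBall_subset_closedBall (by linarith) hx)
    _ = _ := by
      have : Real.exp (s * (a - r ^ 2)) =
          Real.exp (-(3 / 4 * r ^ 2 * s)) * Real.exp (s * (a - (r / 2) ^ 2)) := by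
        rw [← Real.exp_add]
        ring_nf
      rw [this]
      field_simp

end Laplace

/-- Upper bound lemma for the principal eigenvalue, in local Morse coordinates: the
Rayleigh quotient of the cutoff test function `η` with weight `e^{s(a-‖x‖²)}`, metric
coefficients `A`, volume density `ρ` and potential `c` satisfies
`limsup_{s→∞} Q(s) ≤ sup_{closedBall(0,3R)} c`. -/
theorem stmt5 (n : ℕ) (hn : 1 ≤ n) (R a e₂ e₃ e₄ : ℝ) (hR : 0 < R)
    (he₂ : 0 < e₂) (he₃ : 0 < e₃) (he₃₄ : e₃ ≤ e₄)
    (A : EuclideanSpace ℝ (Fin n) → Matrix (Fin n) (Fin n) ℝ) (hA : Continuous A)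
    (hAsym : ∀ x ∈ Metric.closedBall (0 : EuclideanSpace ℝ (Fin n)) (3 * R), (A x).IsSymm)
    (hApsd : ∀ x ∈ Metric.closedBall (0 : EuclideanSpace ℝ (Fin n)) (3 * R),
      ∀ ξ : EuclideanSpace ℝ (Fin n), 0 ≤ quadForm (A x) ξ ξ)
    (hAub : ∀ x ∈ Metric.closedBall (0 : EuclideanSpace ℝ (Fin n)) (3 * R),
      ∀ ξ : EuclideanSpace ℝ (Fin n), quadForm (A x) ξ ξ ≤ e₂ * ‖ξ‖ ^ 2)
    (ρ : EuclideanSpace ℝ (Fin n) → ℝ) (hρ : Continuous ρ)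
    (hρb : ∀ x ∈ Metric.closedBall (0 : EuclideanSpace ℝ (Fin n)) (3 * R),
      e₃ ≤ ρ x ∧ ρ x ≤ e₄)
    (c : EuclideanSpace ℝ (Fin n) → ℝ) (hc : Continuous c)
    (η : EuclideanSpace ℝ (Fin n) → ℝ) (hη : ContDiff ℝ 1 η)
    (hη01 : ∀ x, 0 ≤ η x ∧ η x ≤ 1)
    (hη1 : ∀ x ∈ Metric.closedBall (0 : EuclideanSpace ℝ (Fin n)) R, η x = 1)
    (hη0 : ∀ x ∉ Metric.closedBall (0 : EuclideanSpace ℝ (Fin n)) (3 * R), η x = 0) :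
    Filter.limsup
      (fun s : ℝ =>
        (∫ x in Metric.closedBall (0 : EuclideanSpace ℝ (Fin n)) (3 * R),
          Real.exp (s * (a - ‖x‖ ^ 2)) *
            ((quadForm (A x) (gradient η x) (gradient η x) + c x * (η x) ^ 2) * ρ x)) /
        (∫ x in Metric.closedBall (0 : EuclideanSpace ℝ (Fin n)) (3 * R),
          Real.exp (s * (a - ‖x‖ ^ 2)) * ((η x) ^ 2 * ρ x)))
      Filter.atTop
    ≤ sSup (c '' Metric.closedBall (0 : EuclideanSpace ℝ (Fin n)) (3 * R)) := by
  set B := closedBall (0 : EuclideanSpace ℝ (Fin n)) (3 * R)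
  set q : EuclideanSpace ℝ (Fin n) → ℝ :=
    fun x => quadForm (A x) (gradient η x) (gradient η x) * ρ x
  set w : EuclideanSpace ℝ (Fin n) → ℝ := fun x => η x ^ 2 * ρ x
  set D : ℝ → ℝ := fun s => ∫ x in B, Real.exp (s * (a - ‖x‖ ^ 2)) * w x
  have hη' : Continuous η := hη.continuous
  have hg : Continuous (gradient η) := hη.continuous_gradient
  have hq : Continuous q := (hA.quadForm hg hg).mul hρ
  have hw : Continuous w := by fun_prop
  have hcw : Continuous fun x => c x * w x := hc.mul hw
  have hq0 : ∀ x ∈ B, 0 ≤ q x := fun x hx =>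
    mul_nonneg (hApsd x hx _) (he₃.le.trans (hρb x hx).1)
  have hw0 : ∀ x ∈ B, 0 ≤ w x := fun x hx =>
    mul_nonneg (sq_nonneg _) (he₃.le.trans (hρb x hx).1)
  have hqR : ∀ x ∈ ball (0 : EuclideanSpace ℝ (Fin n)) R, q x = 0 := fun x hx => by
    simp [q, gradient_eq_zero_of_eqOn_ball hη1 hx, quadForm]
  have hRB : closedBall (0 : EuclideanSpace ℝ (Fin n)) R ⊆ B :=
    closedBall_subset_closedBall (by linarith)
  have hwR : ∀ x ∈ closedBall (0 : EuclideanSpace ℝ (Fin n)) R, e₃ ≤ w x := fun x hx => by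
    simpa [w, hη1 x hx] using (hρb x (hRB hx)).1
  have hD : ∀ s, 0 ≤ s → 0 < D s := fun s hs => by
    have hV : 0 < volume.real (closedBall (0 : EuclideanSpace ℝ (Fin n)) R) :=
      ENNReal.toReal_pos (measure_closedBall_pos _ _ hR).ne' measure_closedBall_lt_top.ne
    exact lt_of_lt_of_le (by positivity)
      (mul_exp_le_setIntegral_exp_mul (a := a) (by linarith) hs hR.le he₃.le hw hw0 hwR)
  have hcB : IsCompact (c '' B) := (isCompact_closedBall _ _).image hc
  set F : ℝ → ℝ := fun s => ∫ x in B, Real.exp (s * (a - ‖x‖ ^ 2)) * q x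
  have hF0 : ∀ s, 0 ≤ F s := fun s =>
    setIntegral_nonneg measurableSet_closedBall fun x hx =>
      mul_nonneg (Real.exp_nonneg _) (hq0 x hx)
  have hN : ∀ s, (∫ x in B, Real.exp (s * (a - ‖x‖ ^ 2)) *
      ((quadForm (A x) (gradient η x) (gradient η x) + c x * (η x) ^ 2) * ρ x)) =
      F s + ∫ x in B, Real.exp (s * (a - ‖x‖ ^ 2)) * (c x * w x) := fun s => by
    rw [← integral_add (integrableOn_exp_mul_closedBall hq s a _)
      (integrableOn_exp_mul_closedBall hcw s a _)]
    refine integral_congr_ae (Eventually.of_forall fun x => ?_)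
    simp only [q, w]
    ring
  have hupper : ∀ s, (∫ x in B, Real.exp (s * (a - ‖x‖ ^ 2)) * (c x * w x)) ≤
      sSup (c '' B) * D s := fun s => by
    rw [← integral_const_mul]
    refine setIntegral_mono_on (integrableOn_exp_mul_closedBall hcw s a _)
      ((integrableOn_exp_mul_closedBall hw s a _).const_mul _)
      measurableSet_closedBall fun x hx => ?_
    rw [mul_left_comm]
    exact mul_le_mul_of_nonneg_right (le_csSup hcB.bddAbove ⟨x, hx, rfl⟩)
      (mul_nonneg (Real.exp_nonneg _) (hw0 x hx))
  have hlower : ∀ s, sInf (c '' B) * D s ≤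
      ∫ x in B, Real.exp (s * (a - ‖x‖ ^ 2)) * (c x * w x) := fun s => by
    rw [← integral_const_mul]
    refine setIntegral_mono_on ((integrableOn_exp_mul_closedBall hw s a _).const_mul _)
      (integrableOn_exp_mul_closedBall hcw s a _)
      measurableSet_closedBall fun x hx => ?_
    rw [mul_left_comm _ (c x)]
    exact mul_le_mul_of_nonneg_right (csInf_le hcB.bddBelow ⟨x, hx, rfl⟩)
      (mul_nonneg (Real.exp_nonneg _) (hw0 x hx))
  have hlim : Tendsto (fun s => F s / D s + sSup (c '' B)) atTop (𝓝 (sSup (c '' B))) := by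
    simpa using (tendsto_setIntegral_exp_mul_div_zero (a := a) hR (by linarith : R ≤ 3 * R) he₃
      hq hq0 hqR hw hw0 hwR).add_const (sSup (c '' B))
  rw [← hlim.limsup_eq]
  refine limsup_le_limsup ?_ ?_ hlim.isBoundedUnder_le
  · filter_upwards [eventually_ge_atTop 0] with s hs
    have hDs := hD s hs
    rw [hN, div_add' _ _ _ hDs.ne']
    exact div_le_div_of_nonneg_right (by linarith [hupper s]) hDs.le
  · refine IsBoundedUnder.isCoboundedUnder_le ⟨sInf (c '' B), ?_⟩
    rw [eventually_map]
    filter_upwards [eventually_ge_atTop 0] with s hs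
    rw [hN]
    exact (le_div_iff₀ (hD s hs)).2 (by linarith [hlower s, hF0 s])
end

section
/- Let n ≥ 1 and s ∈ ℝ. Let B : ℝⁿ → Matrix (Fin n) (Fin n) ℝ be continuously differentiable with compact support and with B(x) symmetric for every x. Let f : ℝⁿ → ℝ be twice continuously differentiable and w : ℝⁿ → ℝ continuously differentiable. Then ∫_{ℝⁿ} ⟨∇w − (s/2) w ∇f, B (∇w − (s/2) w ∇f)⟩ dx = ∫_{ℝⁿ} ⟨∇w, B ∇w⟩ dx + (s²/4) ∫_{ℝⁿ} w² ⟨∇f, B ∇f⟩ dx + (s/2) ∫_{ℝⁿ} w² div(B∇f) dx, where div(B∇f)(x) = Σ_{j=1}^{n} ∂_j ( Σ_{i=1}^{n} B_{ij}(x) ∂_i f(x) ). Moreover, if in addition B(x) is positive semidefinite for every x, then ∫_{ℝⁿ} ⟨∇w − (s/2) w ∇f, B (∇w − (s/2) w ∇f)⟩ dx ≥ (s²/4) ∫_{ℝⁿ} w² ⟨∇f, B ∇f⟩ dx + (s/2) ∫_{ℝⁿ} w² div(B∇f) dx. -/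
open MeasureTheory

/-- `div(B∇f)(x) = ∑ⱼ ∂ⱼ (∑ᵢ Bᵢⱼ(x) ∂ᵢ f(x))`. -/
noncomputable def divBgrad (n : ℕ) (B : EuclideanSpace ℝ (Fin n) → Matrix (Fin n) (Fin n) ℝ)
    (f : EuclideanSpace ℝ (Fin n) → ℝ) (x : EuclideanSpace ℝ (Fin n)) : ℝ :=
  ∑ j, fderiv ℝ (fun y => ∑ i, B y i j * fderiv ℝ f y (EuclideanSpace.single i 1)) x
    (EuclideanSpace.single j 1)

section Helpers

variable {n : ℕ}

lemma gradient_euclidean_apply (u : EuclideanSpace ℝ (Fin n) → ℝ) (x : EuclideanSpace ℝ (Fin n))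
    (i : Fin n) : gradient u x i = fderiv ℝ u x (EuclideanSpace.single i 1) := by
  rw [← inner_gradient_left, EuclideanSpace.inner_single_right]
  simp

lemma ContDiff.continuous_gradient_s6 {u : EuclideanSpace ℝ (Fin n) → ℝ} (hu : ContDiff ℝ 1 u) :
    Continuous (gradient u) :=
  (InnerProductSpace.toDual ℝ (EuclideanSpace ℝ (Fin n))).symm.continuous.comp
    (hu.continuous_fderiv one_ne_zero)

lemma quadForm_zero_left_matrix (ξ ζ : EuclideanSpace ℝ (Fin n)) :
    quadForm (0 : Matrix (Fin n) (Fin n) ℝ) ξ ζ = 0 := by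
  simp [quadForm]

lemma quadForm_comm {M : Matrix (Fin n) (Fin n) ℝ} (hM : M.IsSymm)
    (ξ ζ : EuclideanSpace ℝ (Fin n)) : quadForm M ξ ζ = quadForm M ζ ξ := by
  unfold quadForm
  rw [Finset.sum_comm]
  refine Finset.sum_congr rfl fun i _ => Finset.sum_congr rfl fun j _ => ?_
  rw [hM.apply i j]
  ring

lemma quadForm_sub_smul_self {M : Matrix (Fin n) (Fin n) ℝ} (hM : M.IsSymm)
    (ξ ζ : EuclideanSpace ℝ (Fin n)) (c : ℝ) :
    quadForm M (ξ - c • ζ) (ξ - c • ζ) =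
      quadForm M ξ ξ - 2 * c * quadForm M ζ ξ + c ^ 2 * quadForm M ζ ζ := by
  have h : quadForm M (ξ - c • ζ) (ξ - c • ζ) = quadForm M ξ ξ - c * quadForm M ξ ζ
      - c * quadForm M ζ ξ + c ^ 2 * quadForm M ζ ζ := by
    simp only [quadForm, Finset.mul_sum, ← Finset.sum_sub_distrib, ← Finset.sum_add_distrib]
    refine Finset.sum_congr rfl fun i _ => Finset.sum_congr rfl fun j _ => ?_
    simp only [PiLp.sub_apply, PiLp.smul_apply, smul_eq_mul]
    ring
  rw [h, quadForm_comm hM ξ ζ]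
  ring

lemma integrable_mul_quadForm {B : EuclideanSpace ℝ (Fin n) → Matrix (Fin n) (Fin n) ℝ}
    (hB : ∀ i j, Continuous fun x => B x i j) (hBsupp : HasCompactSupport B)
    {a : EuclideanSpace ℝ (Fin n) → ℝ}
    {ξ ζ : EuclideanSpace ℝ (Fin n) → EuclideanSpace ℝ (Fin n)}
    (ha : Continuous a) (hξ : Continuous ξ) (hζ : Continuous ζ) :
    Integrable fun x => a x * quadForm (B x) (ξ x) (ζ x) := by
  refine Continuous.integrable_of_hasCompactSupport ?_ (hBsupp.mono fun x hx hBx => hx ?_)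
  · unfold quadForm
    fun_prop
  · simp [hBx, quadForm_zero_left_matrix]

/-- Integration by parts of the square of a function against a divergence. -/
lemma integral_sq_mul_divergence {w : EuclideanSpace ℝ (Fin n) → ℝ} (hw : ContDiff ℝ 1 w)
    {V : Fin n → EuclideanSpace ℝ (Fin n) → ℝ} (hV : ∀ j, ContDiff ℝ 1 (V j))
    (hVsupp : ∀ j, HasCompactSupport (V j)) :
    ∫ x, w x ^ 2 * ∑ j, fderiv ℝ (V j) x (EuclideanSpace.single j 1) =
      -2 * ∫ x, w x * ∑ j, V j x * fderiv ℝ w x (EuclideanSpace.single j 1) := by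
  have hw2 : ContDiff ℝ 1 fun x => w x ^ 2 := hw.pow 2
  have hdw2 (v x : EuclideanSpace ℝ (Fin n)) :
      fderiv ℝ (fun x => w x ^ 2) x v = 2 * w x * fderiv ℝ w x v := by
    rw [((hw.differentiable one_ne_zero x).hasFDerivAt.pow 2).fderiv]
    simp
  have hcdw := hw.continuous_fderiv one_ne_zero
  have hcdV (j : Fin n) := (hV j).continuous_fderiv one_ne_zero
  have hcw := hw.continuous
  have hcV (j : Fin n) := (hV j).continuous
  have hleft (j : Fin n) :
      Integrable fun x => w x ^ 2 * fderiv ℝ (V j) x (EuclideanSpace.single j 1) :=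
    Continuous.integrable_of_hasCompactSupport (by fun_prop)
      ((hVsupp j).fderiv_apply ℝ _).mul_left
  have hright (j : Fin n) :
      Integrable fun x => w x * (V j x * fderiv ℝ w x (EuclideanSpace.single j 1)) :=
    Continuous.integrable_of_hasCompactSupport (by fun_prop) (hVsupp j).mul_right.mul_left
  simp only [Finset.mul_sum]
  rw [integral_finsetSum _ fun j _ => hleft j, integral_finsetSum _ fun j _ => hright j,
    Finset.mul_sum]
  refine Finset.sum_congr rfl fun j _ => ?_
  have hderiv : (fun x => fderiv ℝ (fun x => w x ^ 2) x (EuclideanSpace.single j 1) * V j x) =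
      fun x => 2 * (w x * (V j x * fderiv ℝ w x (EuclideanSpace.single j 1))) := by
    ext x
    rw [hdw2]
    ring
  rw [integral_mul_fderiv_eq_neg_fderiv_mul_of_integrable
    (by rw [hderiv]; exact (hright j).const_mul 2)
    (hleft j)
    (Continuous.integrable_of_hasCompactSupport (by fun_prop) (hVsupp j).mul_left)
    (fun x _ => hw2.differentiable one_ne_zero x)
    (fun x _ => (hV j).differentiable one_ne_zero x), hderiv, integral_const_mul]
  ring

lemma integral_sq_mul_divBgrad {B : EuclideanSpace ℝ (Fin n) → Matrix (Fin n) (Fin n) ℝ}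
    (hB : ∀ i j, ContDiff ℝ 1 fun x => B x i j) (hBsupp : HasCompactSupport B)
    {f w : EuclideanSpace ℝ (Fin n) → ℝ} (hf : ContDiff ℝ 2 f) (hw : ContDiff ℝ 1 w) :
    ∫ x, w x ^ 2 * divBgrad n B f x =
      -2 * ∫ x, w x * quadForm (B x) (gradient f x) (gradient w x) := by
  have hdf : ContDiff ℝ 1 (fderiv ℝ f) := hf.fderiv_right (by norm_num)
  unfold divBgrad
  rw [integral_sq_mul_divergence hw]
  · congr! 4 with x
    simp only [quadForm, gradient_euclidean_apply, Finset.sum_mul]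
    rw [Finset.sum_comm]
    refine Finset.sum_congr rfl fun i _ => Finset.sum_congr rfl fun j _ => ?_
    ring
  · intro j
    exact ContDiff.sum fun i _ => (hB i j).mul (hdf.clm_apply contDiff_const)
  · exact fun j => hBsupp.mono fun x hx hBx => hx (by simp [hBx])

end Helpers

/-- Expansion, via integration by parts, of the weighted drift Dirichlet energy:
`∫ ⟨∇w - (s/2)w∇f, B(∇w - (s/2)w∇f)⟩ = ∫ ⟨∇w,B∇w⟩ + (s²/4)∫ w²⟨∇f,B∇f⟩
  + (s/2)∫ w² div(B∇f)`, and the resulting lower bound when `B` is pointwise positive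
semidefinite. -/
theorem stmt6 (n : ℕ) (hn : 1 ≤ n) (s : ℝ)
    (B : EuclideanSpace ℝ (Fin n) → Matrix (Fin n) (Fin n) ℝ)
    (hB : ∀ i j, ContDiff ℝ 1 (fun x => B x i j)) (hBsupp : HasCompactSupport B)
    (hBsym : ∀ x, (B x).IsSymm)
    (f : EuclideanSpace ℝ (Fin n) → ℝ) (hf : ContDiff ℝ 2 f)
    (w : EuclideanSpace ℝ (Fin n) → ℝ) (hw : ContDiff ℝ 1 w) :
    (∫ x, quadForm (B x) (gradient w x - ((s / 2) * w x) • gradient f x)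
        (gradient w x - ((s / 2) * w x) • gradient f x)) =
      (∫ x, quadForm (B x) (gradient w x) (gradient w x))
        + (s ^ 2 / 4) * (∫ x, (w x) ^ 2 * quadForm (B x) (gradient f x) (gradient f x))
        + (s / 2) * (∫ x, (w x) ^ 2 * divBgrad n B f x) ∧
    ((∀ x, ∀ ξ : EuclideanSpace ℝ (Fin n), 0 ≤ quadForm (B x) ξ ξ) →
      (s ^ 2 / 4) * (∫ x, (w x) ^ 2 * quadForm (B x) (gradient f x) (gradient f x))
        + (s / 2) * (∫ x, (w x) ^ 2 * divBgrad n B f x) ≤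
      ∫ x, quadForm (B x) (gradient w x - ((s / 2) * w x) • gradient f x)
        (gradient w x - ((s / 2) * w x) • gradient f x)) := by
  have hBc (i j : Fin n) := (hB i j).continuous
  have hwc := hw.continuous
  have hgw := hw.continuous_gradient_s6
  have hgf := (hf.of_le one_le_two).continuous_gradient_s6
  have hww : Integrable fun x => quadForm (B x) (gradient w x) (gradient w x) := by
    simpa using integrable_mul_quadForm hBc hBsupp (continuous_const (y := (1 : ℝ))) hgw hgw
  have hfw : Integrable fun x => w x * quadForm (B x) (gradient f x) (gradient w x) :=
    integrable_mul_quadForm hBc hBsupp hwc hgf hgw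
  have hff : Integrable fun x => w x ^ 2 * quadForm (B x) (gradient f x) (gradient f x) :=
    integrable_mul_quadForm hBc hBsupp (hwc.pow 2) hgf hgf
  have hdiff : Integrable fun x => quadForm (B x) (gradient w x) (gradient w x)
      - s * (w x * quadForm (B x) (gradient f x) (gradient w x)) :=
    hww.sub (hfw.const_mul s)
  have expansion :
      (∫ x, quadForm (B x) (gradient w x - ((s / 2) * w x) • gradient f x)
          (gradient w x - ((s / 2) * w x) • gradient f x)) =
        (∫ x, quadForm (B x) (gradient w x) (gradient w x))
          + (s ^ 2 / 4) * (∫ x, (w x) ^ 2 * quadForm (B x) (gradient f x) (gradient f x))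
          + (s / 2) * (∫ x, (w x) ^ 2 * divBgrad n B f x) := by
    calc
      _ = ∫ x, (quadForm (B x) (gradient w x) (gradient w x)
            - s * (w x * quadForm (B x) (gradient f x) (gradient w x)))
            + (s ^ 2 / 4) * (w x ^ 2 * quadForm (B x) (gradient f x) (gradient f x)) := by
        congr 1 with x
        rw [quadForm_sub_smul_self (hBsym x)]
        ring
      _ = _ := by
        rw [integral_add hdiff (hff.const_mul _),
          integral_sub hww (hfw.const_mul s), integral_const_mul, integral_const_mul,
          integral_sq_mul_divBgrad hB hBsupp hf hw]
        ring
  refine ⟨expansion, fun hpos => ?_⟩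
  have hnonneg : 0 ≤ ∫ x, quadForm (B x) (gradient w x) (gradient w x) :=
    integral_nonneg fun x => hpos x _
  linarith
end

section
/- Let n ≥ 1 and let U ⊆ ℝⁿ be open. Fix an index l ∈ {1,…,n} and a constant γ > 0. Let f : U → ℝ be twice continuously differentiable with ∂²f/∂(x^l)²(x) ≥ γ for all x ∈ U. Let A : U → Matrix (Fin n) (Fin n) ℝ be continuous with A(x) symmetric positive definite for every x ∈ U, and let ρ : U → ℝ be continuously differentiable with ρ(x) > 0 for all x ∈ U. Let K₀ ≥ 0, and for each real s ≥ 1 let w_s : U → ℝ be continuously differentiable with ∫_U w_s(x)² ρ(x) dx ≤ 1 and ∫_U ⟨∇w_s − (s/2) w_s ∇f, A (∇w_s − (s/2) w_s ∇f)⟩(x) ρ(x) dx ≤ K₀. Then for every compact set K ⊆ U, ∫_K w_s(x)² ρ(x) dx → 0 as s → +∞. -/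
open MeasureTheory

open Set Filter Topology
open scoped ContDiff Manifold

theorem integral_fderiv_apply_eq_zero {E : Type*} [NormedAddCommGroup E] [NormedSpace ℝ E]
    [FiniteDimensional ℝ E] [MeasurableSpace E] [BorelSpace E] (μ : Measure E)
    [μ.IsAddHaarMeasure] {g : E → ℝ} (hg : ContDiff ℝ 1 g) (hgc : HasCompactSupport g) (v : E) :
    Integrable (fun x => fderiv ℝ g x v) μ ∧ ∫ x, fderiv ℝ g x v ∂μ = 0 := by
  have hint : Integrable (fun x => fderiv ℝ g x v) μ :=
    ((hg.continuous_fderiv one_ne_zero).clm_apply continuous_const).integrable_of_hasCompactSupport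
      (hgc.fderiv_apply ℝ v)
  refine ⟨hint, ?_⟩
  have h := integral_mul_fderiv_eq_neg_fderiv_mul_of_integrable (μ := μ) (𝕜 := ℝ)
    (f := fun _ : E => (1 : ℝ)) (g := g) (v := v) (by simp) (by simpa using hint)
    (by simpa using hg.continuous.integrable_of_hasCompactSupport hgc)
    (fun x _ => differentiableAt_const _) (fun x _ => hg.differentiable one_ne_zero x)
  simpa using h

theorem exists_contDiff_eq_one_of_isCompact {E : Type*} [NormedAddCommGroup E] [NormedSpace ℝ E]
    [FiniteDimensional ℝ E] {K U : Set E} (hK : IsCompact K) (hU : IsOpen U) (hKU : K ⊆ U) :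
    ∃ φ : E → ℝ, ContDiff ℝ ∞ φ ∧ HasCompactSupport φ ∧ tsupport φ ⊆ U ∧ (∀ x ∈ K, φ x = 1) ∧
      ∀ x, φ x ∈ Icc (0 : ℝ) 1 := by
  obtain ⟨L, hL, hKL, hLU⟩ := exists_compact_between hK hU hKU
  obtain ⟨φ, h1, h0, hI⟩ := exists_contMDiffMap_one_nhds_of_subset_interior (n := ⊤)
    𝓘(ℝ, E) hK.isClosed hKL
  have hsupp : tsupport φ ⊆ L := closure_minimal
    (fun x hx => by_contra fun h => hx (h0 x h)) hL.isClosed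
  exact ⟨φ, φ.contMDiff.contDiff, hL.of_isClosed_subset (isClosed_tsupport _) hsupp,
    hsupp.trans hLU, fun x hx => h1.self_of_nhdsSet x hx, hI⟩

theorem quadForm_smul {n : ℕ} (M : Matrix (Fin n) (Fin n) ℝ) (c : ℝ)
    (ξ : EuclideanSpace ℝ (Fin n)) : quadForm M (c • ξ) (c • ξ) = c ^ 2 * quadForm M ξ ξ := by
  simp only [quadForm, Finset.mul_sum, PiLp.smul_apply, smul_eq_mul]
  exact Finset.sum_congr rfl fun i _ => Finset.sum_congr rfl fun j _ => by ring

theorem exists_mul_norm_sq_le_quadForm {X : Type*} [TopologicalSpace X] {n : ℕ}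
    {A : X → Matrix (Fin n) (Fin n) ℝ} {L : Set X} (hL : IsCompact L) (hA : ContinuousOn A L)
    (hApos : ∀ x ∈ L, ∀ ξ : EuclideanSpace ℝ (Fin n), ξ ≠ 0 → 0 < quadForm (A x) ξ ξ) :
    ∃ c > 0, ∀ x ∈ L, ∀ ξ : EuclideanSpace ℝ (Fin n), c * ‖ξ‖ ^ 2 ≤ quadForm (A x) ξ ξ := by
  have hcont : ContinuousOn (fun p : X × EuclideanSpace ℝ (Fin n) => quadForm (A p.1) p.2 p.2)
      (L ×ˢ Metric.sphere 0 1) := by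
    have hA' : ContinuousOn (fun p : X × EuclideanSpace ℝ (Fin n) => A p.1)
        (L ×ˢ Metric.sphere 0 1) := hA.comp continuousOn_fst fun p hp => hp.1
    unfold quadForm
    refine continuousOn_finsetSum _ fun i _ => continuousOn_finsetSum _ fun j _ => ?_
    have hij : ContinuousOn (fun p : X × EuclideanSpace ℝ (Fin n) => A p.1 i j)
        (L ×ˢ Metric.sphere 0 1) :=
      (continuous_id.matrix_elem i j).comp_continuousOn hA'
    have hcoord : ∀ k, ContinuousOn (fun p : X × EuclideanSpace ℝ (Fin n) => p.2 k)
        (L ×ˢ Metric.sphere 0 1) := fun k =>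
      ((EuclideanSpace.proj (𝕜 := ℝ) k).continuous.comp continuous_snd).continuousOn
    exact ((hcoord i).mul hij).mul (hcoord j)
  obtain ⟨c, hc, hcle⟩ := (hL.prod (isCompact_sphere 0 1)).exists_forall_le' hcont (a := 0)
    fun p hp => hApos p.1 hp.1 p.2 (ne_zero_of_mem_unit_sphere ⟨p.2, hp.2⟩)
  refine ⟨c, hc, fun x hx ξ => ?_⟩
  rcases eq_or_ne ξ 0 with rfl | hξ
  · simp [quadForm]
  have hn : 0 < ‖ξ‖ := norm_pos_iff.2 hξ
  have h := hcle (x, ‖ξ‖⁻¹ • ξ) ⟨hx, by simp [norm_smul, hn.ne']⟩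
  rw [quadForm_smul, inv_pow, inv_mul_eq_div, le_div_iff₀ (by positivity)] at h
  exact h

theorem gradient_apply_eq_fderiv_single {n : ℕ} (f : EuclideanSpace ℝ (Fin n) → ℝ)
    (x : EuclideanSpace ℝ (Fin n)) (l : Fin n) :
    gradient f x l = fderiv ℝ f x (EuclideanSpace.single l 1) := by
  rw [← inner_gradient_left, EuclideanSpace.inner_single_right]
  simp

/-- If `h`, `w` are `C¹` on an open set containing the support of the cutoff `φ`, then
`h (φ w)²` is `C¹` on the whole space. -/
theorem contDiff_mul_cutoff_sq {E : Type*} [NormedAddCommGroup E] [NormedSpace ℝ E]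
    {U : Set E} (hU : IsOpen U) {h w φ : E → ℝ} (hh : ContDiffOn ℝ 1 h U)
    (hw : ContDiffOn ℝ 1 w U) (hφ : ContDiff ℝ 1 φ) (hφU : tsupport φ ⊆ U) :
    ContDiff ℝ 1 fun x => h x * (φ x * w x) ^ 2 := by
  refine contDiff_iff_contDiffAt.2 fun x => ?_
  by_cases hx : x ∈ tsupport fun y => h y * (φ y * w y) ^ 2
  swap
  · exact (contDiffAt_const (c := (0 : ℝ))).congr_of_eventuallyEq
      (notMem_tsupport_iff_eventuallyEq.1 hx)
  have hsupp : Function.support (fun y => h y * (φ y * w y) ^ 2) ⊆ Function.support φ :=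
    fun y hy hφy => hy (by simp [hφy])
  have hxU : x ∈ U := hφU (closure_mono hsupp hx)
  have hn := hU.mem_nhds hxU
  exact (hh.contDiffAt hn).mul ((hφ.contDiffAt.mul (hw.contDiffAt hn)).pow 2)

theorem fderiv_mul_cutoff_sq_apply {E : Type*} [NormedAddCommGroup E] [NormedSpace ℝ E]
    {h w φ : E → ℝ} {x : E} (hh : DifferentiableAt ℝ h x) (hw : DifferentiableAt ℝ w x)
    (hφ : DifferentiableAt ℝ φ x) (v : E) :
    fderiv ℝ (fun y => h y * (φ y * w y) ^ 2) x v =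
      fderiv ℝ h x v * (φ x * w x) ^ 2 +
        2 * h x * (φ x * w x) * (φ x * fderiv ℝ w x v + fderiv ℝ φ x v * w x) := by
  have H := hh.hasFDerivAt.mul ((hφ.hasFDerivAt.mul hw.hasFDerivAt).pow 2)
  have H' : HasFDerivAt (fun y => h y * (φ y * w y) ^ 2) _ x := H
  rw [H'.fderiv]
  simp
  ring

/-- Local-coordinate content of Lemma 3.3 (`μ(M₂) = 0`): on a chart where the second
partial derivative `∂²f/∂(xˡ)²` is bounded below by `γ > 0` (as near a non-degenerate
critical point which is not a local maximum, in Morse coordinates), the normalized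
densities `w_s² ρ` with uniformly bounded drift Dirichlet energy lose all their mass
on every compact subset as `s → +∞`. -/
theorem stmt9 (n : ℕ) (hn : 1 ≤ n)
    (U : Set (EuclideanSpace ℝ (Fin n))) (hU : IsOpen U)
    (l : Fin n) (γ : ℝ) (hγ : 0 < γ)
    (f : EuclideanSpace ℝ (Fin n) → ℝ) (hf : ContDiffOn ℝ 2 f U)
    (hfll : ∀ x ∈ U, γ ≤
      fderiv ℝ (fun y => fderiv ℝ f y (EuclideanSpace.single l 1)) x
        (EuclideanSpace.single l 1))
    (A : EuclideanSpace ℝ (Fin n) → Matrix (Fin n) (Fin n) ℝ)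
    (hA : ContinuousOn A U)
    (hAsym : ∀ x ∈ U, (A x).IsSymm)
    (hApos : ∀ x ∈ U, ∀ ξ : EuclideanSpace ℝ (Fin n), ξ ≠ 0 → 0 < quadForm (A x) ξ ξ)
    (ρ : EuclideanSpace ℝ (Fin n) → ℝ) (hρ : ContDiffOn ℝ 1 ρ U)
    (hρpos : ∀ x ∈ U, 0 < ρ x)
    (K₀ : ℝ) (hK₀ : 0 ≤ K₀)
    (w : ℝ → EuclideanSpace ℝ (Fin n) → ℝ)
    (hw : ∀ s : ℝ, 1 ≤ s → ContDiffOn ℝ 1 (w s) U)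
    (hwint : ∀ s : ℝ, 1 ≤ s → IntegrableOn (fun x => (w s x) ^ 2 * ρ x) U)
    (hwnorm : ∀ s : ℝ, 1 ≤ s → (∫ x in U, (w s x) ^ 2 * ρ x) ≤ 1)
    (heint : ∀ s : ℝ, 1 ≤ s →
      IntegrableOn (fun x =>
        quadForm (A x) (gradient (w s) x - ((s / 2) * w s x) • gradient f x)
          (gradient (w s) x - ((s / 2) * w s x) • gradient f x) * ρ x) U)
    (henergy : ∀ s : ℝ, 1 ≤ s →
      (∫ x in U,
        quadForm (A x) (gradient (w s) x - ((s / 2) * w s x) • gradient f x)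
          (gradient (w s) x - ((s / 2) * w s x) • gradient f x) * ρ x) ≤ K₀) :
    ∀ K : Set (EuclideanSpace ℝ (Fin n)), IsCompact K → K ⊆ U →
      Filter.Tendsto (fun s : ℝ => ∫ x in K, (w s x) ^ 2 * ρ x)
        Filter.atTop (nhds 0) := by
  intro K hK hKU
  set e : EuclideanSpace ℝ (Fin n) := EuclideanSpace.single l 1 with he
  obtain ⟨φ, hφ, hφc, hφU, hφK, hφI⟩ := exists_contDiff_eq_one_of_isCompact hK hU hKU
  have hφ1 : ContDiff ℝ 1 φ := hφ.of_le (by exact_mod_cast le_top)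
  have hLc : IsCompact (tsupport φ) := hφc
  obtain ⟨c, hc, hcA⟩ := exists_mul_norm_sq_le_quadForm hLc (hA.mono hφU)
    fun x hx => hApos x (hφU hx)
  have hρc : ContinuousOn ρ (tsupport φ) := hρ.continuousOn.mono hφU
  obtain ⟨m, hm, hmρ⟩ := hLc.exists_forall_le' hρc (a := 0) fun x hx => hρpos x (hφU hx)
  obtain ⟨M, hM⟩ := hLc.bddAbove_image hρc
  obtain ⟨B, hB⟩ := hLc.bddAbove_image (f := fun x => (fderiv ℝ φ x e) ^ 2)
    (((hφ1.continuous_fderiv one_ne_zero).clm_apply continuous_const).pow 2).continuousOn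
  have hMρ : ∀ x ∈ tsupport φ, ρ x ≤ |M| := fun x hx =>
    (hM (mem_image_of_mem _ hx)).trans (le_abs_self M)
  have hBφ : ∀ x ∈ tsupport φ, (fderiv ℝ φ x e) ^ 2 ≤ |B| := fun x hx =>
    (hB (mem_image_of_mem _ hx)).trans (le_abs_self B)
  have hDf : ContDiffOn ℝ 1 (fun y => fderiv ℝ f y e) U :=
    (hf.fderiv_of_isOpen hU (by norm_num)).clm_apply contDiffOn_const
  set Q : ℝ → EuclideanSpace ℝ (Fin n) → ℝ := fun s x =>
    quadForm (A x) (gradient (w s) x - ((s / 2) * w s x) • gradient f x)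
      (gradient (w s) x - ((s / 2) * w s x) • gradient f x) * ρ x
  have hQ0 : ∀ s, ∀ x ∈ U, 0 ≤ Q s x := by
    intro s x hx
    refine mul_nonneg ?_ (hρpos x hx).le
    rcases eq_or_ne (gradient (w s) x - ((s / 2) * w s x) • gradient f x) 0 with h0 | h0
    · simp [h0, quadForm]
    · exact (hApos x hx _ h0).le
  let g : ℝ → EuclideanSpace ℝ (Fin n) → ℝ := fun s x => fderiv ℝ f x e * (φ x * w s x) ^ 2
  let R : ℝ → EuclideanSpace ℝ (Fin n) → ℝ := fun s x =>
    s * fderiv ℝ (g s) x e + 2 / (c * m) * Q s x + 2 * |B| / m * (w s x ^ 2 * ρ x)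
  have key : ∀ s, 1 ≤ s → ∀ x ∈ U, s * γ * (φ x * w s x) ^ 2 ≤ R s x := by
    intro s hs x hx
    have hn := hU.mem_nhds hx
    have hwρ : 0 ≤ w s x ^ 2 * ρ x := mul_nonneg (sq_nonneg _) (hρpos x hx).le
    have hg : fderiv ℝ (g s) x e = _ := fderiv_mul_cutoff_sq_apply
      ((hDf.contDiffAt hn).differentiableAt one_ne_zero)
      (((hw s hs).contDiffAt hn).differentiableAt one_ne_zero)
      (hφ1.differentiable one_ne_zero x) e
    simp only [R]
    by_cases hxL : x ∈ tsupport φ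
    · set E : ℝ := fderiv ℝ (w s) x e - s / 2 * w s x * fderiv ℝ f x e with hE
      have hEQ : E ^ 2 ≤ 1 / (c * m) * Q s x := by
        set ξ := gradient (w s) x - ((s / 2) * w s x) • gradient f x with hξ
        have hξl : ξ l = E := by
          simp [hξ, hE, gradient_apply_eq_fderiv_single, he]
        have h1 : E ^ 2 ≤ ‖ξ‖ ^ 2 := by
          rw [← hξl, sq_le_sq, abs_norm]
          exact PiLp.norm_apply_le ξ l
        have h2 : c * m * ‖ξ‖ ^ 2 ≤ Q s x :=
          calc c * m * ‖ξ‖ ^ 2 = c * ‖ξ‖ ^ 2 * m := by ring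
            _ ≤ _ := mul_le_mul (hcA x hxL ξ) (hmρ x hxL) hm.le
              (le_trans (by positivity) (hcA x hxL ξ))
        rw [one_div_mul_eq_div, le_div_iff₀ (by positivity)]
        nlinarith [mul_pos hc hm]
      have hφE : (φ x * E) ^ 2 ≤ 1 / (c * m) * Q s x := by
        refine le_trans ?_ hEQ
        rw [mul_pow]
        exact mul_le_of_le_one_left (sq_nonneg _) (pow_le_one₀ (hφI x).1 (hφI x).2)
      have hBw : (fderiv ℝ φ x e * w s x) ^ 2 ≤ |B| / m * (w s x ^ 2 * ρ x) :=
        calc (fderiv ℝ φ x e * w s x) ^ 2 = (fderiv ℝ φ x e) ^ 2 * w s x ^ 2 := mul_pow _ _ _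
          _ ≤ |B| * w s x ^ 2 := by gcongr; exact hBφ x hxL
          _ = |B| / m * (w s x ^ 2 * m) := by field_simp
          _ ≤ _ := by gcongr; exact hmρ x hxL
      have hf2 : s * γ * (φ x * w s x) ^ 2 ≤
          s * (fderiv ℝ (fun y => fderiv ℝ f y e) x e * (φ x * w s x) ^ 2) := by
        rw [mul_assoc]
        gcongr
        exact hfll x hx
      have hsq := sq_nonneg (φ x * fderiv ℝ (w s) x e + fderiv ℝ φ x e * w s x
        + s / 2 * fderiv ℝ f x e * (φ x * w s x))
      have hsub := sq_nonneg (φ x * E - fderiv ℝ φ x e * w s x)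
      rw [hg]
      have e1 : 2 / (c * m) * Q s x = 2 * (1 / (c * m) * Q s x) := by ring
      have e2 : 2 * |B| / m * (w s x ^ 2 * ρ x) = 2 * (|B| / m * (w s x ^ 2 * ρ x)) := by ring
      rw [e1, e2]
      rw [hE] at hφE hsub
      linarith
    · have h0 : φ x = 0 := image_eq_zero_of_notMem_tsupport hxL
      have hQx := hQ0 s x hx
      rw [hg, h0]
      simp only [zero_mul, mul_zero, ne_eq, OfNat.ofNat_ne_zero, not_false_eq_true, zero_pow,
        add_zero, zero_add]
      positivity
  have hbound : ∀ s, 1 ≤ s → ∫ x in K, w s x ^ 2 * ρ x ≤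
      (|M| / γ * (2 / (c * m) * K₀ + 2 * |B| / m)) / s := by
    intro s hs
    have hs0 : 0 < s := by linarith
    have hg : ContDiff ℝ 1 (g s) := contDiff_mul_cutoff_sq hU hDf (hw s hs) hφ1 hφU
    have hsupp : Function.support (g s) ⊆ Function.support φ :=
      fun x hx h0 => hx (by simp [g, h0])
    have hgc : HasCompactSupport (g s) := hφc.mono hsupp
    obtain ⟨hgi, hg0⟩ := integral_fderiv_apply_eq_zero volume hg hgc e
    have hi1 : IntegrableOn (fun x => s * fderiv ℝ (g s) x e) U := (hgi.const_mul s).integrableOn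
    have hi2 : IntegrableOn (fun x => 2 / (c * m) * Q s x) U := (heint s hs).const_mul _
    have hi3 : IntegrableOn (fun x => 2 * |B| / m * (w s x ^ 2 * ρ x)) U :=
      (hwint s hs).const_mul _
    have hRi : IntegrableOn (R s) U := (hi1.add hi2).add hi3
    have hgU : ∫ x in U, fderiv ℝ (g s) x e = 0 := by
      rw [setIntegral_eq_integral_of_forall_compl_eq_zero, hg0]
      intro x hx
      have hx' : x ∉ tsupport (g s) := fun h => hx (hφU (closure_mono hsupp h))
      rw [image_eq_zero_of_notMem_tsupport
        (fun h => hx' (tsupport_fderiv_apply_subset ℝ e h))]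
    have hRle : ∫ x in U, R s x ≤ 2 / (c * m) * K₀ + 2 * |B| / m := by
      have hsplit : ∫ x in U, R s x = s * (∫ x in U, fderiv ℝ (g s) x e) +
          2 / (c * m) * (∫ x in U, Q s x) + 2 * |B| / m * ∫ x in U, w s x ^ 2 * ρ x := by
        rw [← integral_const_mul, ← integral_const_mul, ← integral_const_mul,
          ← integral_add hi1 hi2]
        exact integral_add (hi1.add hi2) hi3
      rw [hsplit, hgU, mul_zero, zero_add]
      have h1 := mul_le_mul_of_nonneg_left (henergy s hs) (by positivity : 0 ≤ 2 / (c * m))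
      have h2 := mul_le_mul_of_nonneg_left (hwnorm s hs) (by positivity : 0 ≤ 2 * |B| / m)
      linarith
    have hKle : ∫ x in K, w s x ^ 2 * ρ x ≤ ∫ x in K, |M| / (s * γ) * R s x := by
      refine setIntegral_mono_on ((hwint s hs).mono_set hKU) ((hRi.mono_set hKU).const_mul _)
        hK.measurableSet fun x hx => ?_
      have hk := key s hs x (hKU hx)
      rw [hφK x hx, one_mul] at hk
      have hxL : x ∈ tsupport φ := subset_tsupport φ (by simp [hφK x hx])
      calc w s x ^ 2 * ρ x ≤ w s x ^ 2 * |M| := by gcongr; exact hMρ x hxL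
        _ = |M| / (s * γ) * (s * γ * w s x ^ 2) := by field_simp
        _ ≤ _ := by gcongr
    have hKU' : ∫ x in K, R s x ≤ ∫ x in U, R s x :=
      setIntegral_mono_set hRi ((ae_restrict_iff' hU.measurableSet).2 <| ae_of_all _ fun x hx =>
        le_trans (by positivity) (key s hs x hx)) (LE.le.eventuallyLE hKU)
    calc ∫ x in K, w s x ^ 2 * ρ x ≤ |M| / (s * γ) * ∫ x in K, R s x := by
          rwa [integral_const_mul] at hKle
      _ ≤ |M| / (s * γ) * (2 / (c * m) * K₀ + 2 * |B| / m) := by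
          gcongr; exact hKU'.trans hRle
      _ = _ := by field_simp
  refine tendsto_of_tendsto_of_tendsto_of_le_of_le' tendsto_const_nhds
    (tendsto_id.const_div_atTop (|M| / γ * (2 / (c * m) * K₀ + 2 * |B| / m))) ?_ ?_
  · exact Eventually.of_forall fun s => setIntegral_nonneg hK.measurableSet fun x hx =>
      mul_nonneg (sq_nonneg _) (hρpos x (hKU hx)).le
  · filter_upwards [eventually_ge_atTop 1] with s hs using hbound s hs
end
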